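/- Let h : ℝ × (ℝ∖{0}) → ℝ be h(a,b) = a³/(3b²). Then for all (a,b) with b ≠ 0: (i) ∂ₐ³h = 2/b² (in particular the structural function u = ½∂ₐ³h = 1/b² is nowhere zero); (ii) ∂ₐ⁴h = 0 and ∂ₐ⁴∂_b h = 0, and 3(∂ₐ³∂_b h)² − 2(∂ₐ³h)(∂ₐ³∂_b²h) = 0, hence the invariant I₃ = ¼(3h_{ab-ab}∂ₐ⁴h-terms) := ¼(3(∂ₐ³∂_bh)(∂ₐ⁴h) − 2(∂ₐ³h)(∂ₐ⁴∂_bh) + 2y₄(3(∂ₐ³∂_bh)² − 2(∂ₐ³h)(∂ₐ³∂_b²h))) vanishes identically for every y₄ ∈ ℝ; (iii) 4(∂ₐ³∂_b h)² − 3(∂ₐ³h)(∂ₐ³∂_b²h) = −8/b⁶, hence the invariant R = ¼(4(∂ₐ³∂_bh)² − 3(∂ₐ³h)(∂ₐ³∂_b²h)) equals −2/b⁶ and is nowhere zero. -/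

import Mathlib

noncomputable section

/-- Partial derivative in the first argument (`∂ₐ`) of a function on `ℝ²`. -/
def pa (g : ℝ × ℝ → ℝ) : ℝ × ℝ → ℝ := fun p => fderiv ℝ g p (1, 0)

/-- Partial derivative in the second argument (`∂_b`) of a function on `ℝ²`. -/
def pb (g : ℝ × ℝ → ℝ) : ℝ × ℝ → ℝ := fun p => fderiv ℝ g p (0, 1)

/-- `h(a,b) = a³/(3b²)`, the function producing the Monge structures with exactly
9-dimensional symmetry. -/
def h18 : ℝ × ℝ → ℝ := fun p => p.1 ^ 3 / (3 * p.2 ^ 2)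

theorem mon_fderiv (g : ℝ × ℝ → ℝ) (c : ℝ) (m n : ℕ)
    (hg : ∀ p : ℝ × ℝ, p.2 ≠ 0 → g p = c * p.1 ^ m / p.2 ^ n)
    (p : ℝ × ℝ) (hp : p.2 ≠ 0) (v : ℝ × ℝ) :
    fderiv ℝ g p v = c * m * p.1 ^ (m - 1) / p.2 ^ n * v.1
      + -(c * n) * p.1 ^ m / p.2 ^ (n + 1) * v.2 := by
  have hev : g =ᶠ[nhds p] fun q => (c * q.1 ^ m) * (q.2 ^ n)⁻¹ := by
    have ho : IsOpen {q : ℝ × ℝ | q.2 ≠ 0} := isOpen_ne_fun continuous_snd continuous_const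
    filter_upwards [ho.mem_nhds hp] with q hq
    rw [hg q hq, div_eq_mul_inv]
  have h1 : HasFDerivAt (fun q : ℝ × ℝ => q.1) (ContinuousLinearMap.fst ℝ ℝ ℝ) p :=
    hasFDerivAt_fst
  have h2 : HasFDerivAt (fun q : ℝ × ℝ => q.2) (ContinuousLinearMap.snd ℝ ℝ ℝ) p :=
    hasFDerivAt_snd
  have h3 := ((hasDerivAt_pow m p.1).const_mul c).comp_hasFDerivAt p h1
  have h4 := ((hasDerivAt_pow n p.2).inv (pow_ne_zero n hp)).comp_hasFDerivAt p h2
  have h5 := h3.mul h4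
  rw [hev.fderiv_eq]
  have h6 := h5.fderiv
  have h7 : fderiv ℝ (fun q : ℝ × ℝ => (c * q.1 ^ m) * (q.2 ^ n)⁻¹) p = _ := h6
  rw [h7]
  rcases n with _ | n
  · simp
    left
    ring
  · simp
    field_simp
    ring

theorem pa_mon (g : ℝ × ℝ → ℝ) (c : ℝ) (m n : ℕ)
    (hg : ∀ p : ℝ × ℝ, p.2 ≠ 0 → g p = c * p.1 ^ m / p.2 ^ n)
    (p : ℝ × ℝ) (hp : p.2 ≠ 0) :
    pa g p = (c * m) * p.1 ^ (m - 1) / p.2 ^ n := by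
  simp [pa, mon_fderiv g c m n hg p hp]

theorem pb_mon (g : ℝ × ℝ → ℝ) (c : ℝ) (m n : ℕ)
    (hg : ∀ p : ℝ × ℝ, p.2 ≠ 0 → g p = c * p.1 ^ m / p.2 ^ n)
    (p : ℝ × ℝ) (hp : p.2 ≠ 0) :
    pb g p = (-(c * n)) * p.1 ^ m / p.2 ^ (n + 1) := by
  simp [pb, mon_fderiv g c m n hg p hp]

/-- For `h(a,b) = a³/(3b²)` and `b ≠ 0`: (i) `∂ₐ³h = 2/b²`, so `u = ½∂ₐ³h = 1/b² ≠ 0`;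
(ii) `∂ₐ⁴h = 0`, `∂ₐ⁴∂_bh = 0`, `3(∂ₐ³∂_bh)² − 2(∂ₐ³h)(∂ₐ³∂_b²h) = 0`, hence the
invariant `I₃` vanishes for every `y₄`; (iii) `4(∂ₐ³∂_bh)² − 3(∂ₐ³h)(∂ₐ³∂_b²h) = −8/b⁶`,
hence the invariant `R = −2/b⁶` is nowhere zero. -/
theorem h18_invariants :
    ∀ a b : ℝ, b ≠ 0 →
      (pa (pa (pa h18)) (a, b) = 2 / b ^ 2 ∧
        (1/2 : ℝ) * pa (pa (pa h18)) (a, b) = 1 / b ^ 2 ∧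
        (1/2 : ℝ) * pa (pa (pa h18)) (a, b) ≠ 0) ∧
      (pa (pa (pa (pa h18))) (a, b) = 0 ∧
        pb (pa (pa (pa (pa h18)))) (a, b) = 0 ∧
        3 * (pb (pa (pa (pa h18))) (a, b)) ^ 2
          - 2 * pa (pa (pa h18)) (a, b) * pb (pb (pa (pa (pa h18)))) (a, b) = 0 ∧
        ∀ y4 : ℝ,
          (1/4 : ℝ) * (3 * pb (pa (pa (pa h18))) (a, b) * pa (pa (pa (pa h18))) (a, b)
            - 2 * pa (pa (pa h18)) (a, b) * pb (pa (pa (pa (pa h18)))) (a, b)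
            + 2 * y4 * (3 * (pb (pa (pa (pa h18))) (a, b)) ^ 2
              - 2 * pa (pa (pa h18)) (a, b) * pb (pb (pa (pa (pa h18)))) (a, b))) = 0) ∧
      (4 * (pb (pa (pa (pa h18))) (a, b)) ^ 2
          - 3 * pa (pa (pa h18)) (a, b) * pb (pb (pa (pa (pa h18)))) (a, b) = -8 / b ^ 6 ∧
        (1/4 : ℝ) * (4 * (pb (pa (pa (pa h18))) (a, b)) ^ 2
          - 3 * pa (pa (pa h18)) (a, b) * pb (pb (pa (pa (pa h18)))) (a, b)) = -2 / b ^ 6 ∧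
        (1/4 : ℝ) * (4 * (pb (pa (pa (pa h18))) (a, b)) ^ 2
          - 3 * pa (pa (pa h18)) (a, b) * pb (pb (pa (pa (pa h18)))) (a, b)) ≠ 0) := by
  intro a b hb
  have h0 : ∀ p : ℝ × ℝ, p.2 ≠ 0 → h18 p = (1 / 3) * p.1 ^ 3 / p.2 ^ 2 := by
    intro p hp
    simp only [h18]
    field_simp
  have h3 := pa_mon _ _ _ _ (pa_mon _ _ _ _ (pa_mon _ _ _ _ h0))
  have h4 := pa_mon _ _ _ _ h3
  have h4b := pb_mon _ _ _ _ h4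
  have h3b := pb_mon _ _ _ _ h3
  have h3bb := pb_mon _ _ _ _ h3b
  have e3 : pa (pa (pa h18)) (a, b) = 2 / b ^ 2 := by
    rw [h3 (a, b) hb]; norm_num
  have e4 : pa (pa (pa (pa h18))) (a, b) = 0 := by
    rw [h4 (a, b) hb]; norm_num
  have e4b : pb (pa (pa (pa (pa h18)))) (a, b) = 0 := by
    rw [h4b (a, b) hb]; norm_num
  have e3b : pb (pa (pa (pa h18))) (a, b) = -4 / b ^ 3 := by
    rw [h3b (a, b) hb]; norm_num
  have e3bb : pb (pb (pa (pa (pa h18)))) (a, b) = 12 / b ^ 4 := by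
    rw [h3bb (a, b) hb]; norm_num
  have k2 : 3 * (-4 / b ^ 3) ^ 2 - 2 * (2 / b ^ 2) * (12 / b ^ 4) = 0 := by
    field_simp; ring
  have k3 : 4 * (-4 / b ^ 3) ^ 2 - 3 * (2 / b ^ 2) * (12 / b ^ 4) = -8 / b ^ 6 := by
    field_simp; ring
  have k4 : (1/4 : ℝ) * (-8 / b ^ 6) = -2 / b ^ 6 := by ring
  rw [e3, e4, e4b, e3b, e3bb, k2, k3, k4]
  refine ⟨⟨rfl, by ring, ?_⟩, ⟨rfl, rfl, rfl, fun y4 => by ring⟩, rfl, rfl, ?_⟩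
  · positivity
  · exact div_ne_zero (by norm_num) (pow_ne_zero _ hb)
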